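/- Suppose γ > 0 and λ_2 := sup σ(H²) > 0. Then λ_2 is isolated in the spectrum of the restriction H²_S of H² to the subspace S of symmetric functions: there exists ε > 0 such that σ(H²_S) ∩ (λ_2 − ε, λ_2 + ε) = {λ_2}. -/

import Mathlib

open Filter Topology

section Abstract

variable {E : Type*} [NormedAddCommGroup E] [InnerProductSpace ℝ E]

/-- Cauchy–Schwarz for the semi-inner product of a nonnegative symmetric operator. -/
lemma norm_sq_apply_le_of_nonneg {P : E →L[ℝ] E} (hP : (P : E →ₗ[ℝ] E).IsSymmetric)
    (hpos : ∀ x, 0 ≤ inner ℝ (P x) x) (x : E) : ‖P x‖ ^ 2 ≤ ‖P‖ * inner ℝ (P x) x := by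
  rcases (norm_nonneg P).eq_or_lt with h0 | h0
  · have : P = 0 := norm_eq_zero.1 h0.symm
    simp [this]
  have h1 := hpos (x - (‖P‖⁻¹ : ℝ) • P x)
  have h2 : inner ℝ (P (P x)) x = ‖P x‖ ^ 2 := by
    rw [← real_inner_self_eq_norm_sq]
    exact hP (P x) x
  have h3 : inner ℝ (P (P x)) (P x) ≤ ‖P‖ * ‖P x‖ ^ 2 := by
    calc inner ℝ (P (P x)) (P x) ≤ ‖P (P x)‖ * ‖P x‖ := real_inner_le_norm _ _
      _ ≤ (‖P‖ * ‖P x‖) * ‖P x‖ := by gcongr; exact P.le_opNorm _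
      _ = _ := by ring
  simp only [map_sub, map_smul, inner_sub_left, inner_sub_right, inner_smul_left,
    inner_smul_right, h2, real_inner_self_eq_norm_sq] at h1
  simp only [RCLike.conj_to_real] at h1
  have h4 : ‖P‖⁻¹ * (‖P‖⁻¹ * inner ℝ (P (P x)) (P x)) ≤ ‖P‖⁻¹ * ‖P x‖ ^ 2 := by
    have := mul_le_mul_of_nonneg_left h3 (by positivity : 0 ≤ ‖P‖⁻¹ * ‖P‖⁻¹)
    calc _ = ‖P‖⁻¹ * ‖P‖⁻¹ * inner ℝ (P (P x)) (P x) := by ring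
      _ ≤ _ := this
      _ = _ := by field_simp
  have h5 : ‖P‖⁻¹ * ‖P x‖ ^ 2 ≤ inner ℝ (P x) x := by linarith
  calc ‖P x‖ ^ 2 = ‖P‖ * (‖P‖⁻¹ * ‖P x‖ ^ 2) := by field_simp
    _ ≤ _ := by gcongr

lemma isSymmetric_smul_id_sub {T : E →L[ℝ] E} (hT : (T : E →ₗ[ℝ] E).IsSymmetric) (l : ℝ) :
    ((algebraMap ℝ (E →L[ℝ] E) l - T : E →L[ℝ] E) : E →ₗ[ℝ] E).IsSymmetric := by
  intro x y
  have := hT x y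
  simp only [ContinuousLinearMap.coe_coe] at this
  simp [Algebra.algebraMap_eq_smul_one, inner_sub_left, inner_sub_right, inner_smul_left,
    inner_smul_right, this]

variable [CompleteSpace E]

lemma isUnit_of_bounded_below {T : E →L[ℝ] E} (hT : (T : E →ₗ[ℝ] E).IsSymmetric) {c : ℝ}
    (hc : 0 < c) (h : ∀ x, c * ‖x‖ ≤ ‖T x‖) : IsUnit T := by
  rw [← isUnit_pow_iff (two_ne_zero)]
  refine ContinuousLinearMap.isUnit_of_forall_le_norm_inner_map _ (c := ⟨c ^ 2, by positivity⟩)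
    (by change (0 : ℝ) < c ^ 2; positivity) fun x => ?_
  have h1 : inner ℝ ((T ^ 2) x) x = ‖T x‖ ^ 2 := by
    rw [← real_inner_self_eq_norm_sq, pow_two]
    exact hT (T x) x
  rw [h1]
  change ‖x‖ ^ 2 * c ^ 2 ≤ _
  rw [Real.norm_of_nonneg (by positivity), ← mul_pow, mul_comm]
  have := h x
  gcongr

/-- Every spectral value of a symmetric operator is an approximate eigenvalue. -/
lemma exists_approx_eigenvector {T : E →L[ℝ] E} (hT : (T : E →ₗ[ℝ] E).IsSymmetric) {l : ℝ}
    (hl : l ∈ spectrum ℝ T) {ε : ℝ} (hε : 0 < ε) : ∃ x, ‖x‖ = 1 ∧ ‖T x - l • x‖ < ε := by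
  by_contra! hcon
  refine hl (isUnit_of_bounded_below (isSymmetric_smul_id_sub hT l) hε fun x => ?_)
  rcases eq_or_ne x 0 with rfl | hx
  · simp
  have hx' : 0 < ‖x‖ := norm_pos_iff.2 hx
  have := hcon (‖x‖⁻¹ • x) (by rw [norm_smul]; simp [hx'.ne'])
  have h2 : T (‖x‖⁻¹ • x) - l • ‖x‖⁻¹ • x = -(‖x‖⁻¹ • (algebraMap ℝ (E →L[ℝ] E) l - T) x) := by
    simp only [map_smul, Algebra.algebraMap_eq_smul_one, sub_apply,
      smul_apply, one_apply_eq_self, smul_sub, neg_sub]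
    rw [smul_comm]
  rw [h2, norm_neg, norm_smul, norm_inv, norm_norm] at this
  calc ε * ‖x‖ ≤ (‖x‖⁻¹ * ‖(algebraMap ℝ (E →L[ℝ] E) l - T) x‖) * ‖x‖ := by gcongr
    _ = _ := by field_simp

/-- The quadratic form of a symmetric operator is bounded by the supremum of its spectrum. -/
lemma inner_apply_self_le_sSup_spectrum {T : E →L[ℝ] E} (hT : (T : E →ₗ[ℝ] E).IsSymmetric)
    (x : E) : inner ℝ (T x) x ≤ sSup (spectrum ℝ T) * ‖x‖ ^ 2 := by
  set A : Set ℝ := (fun y => inner ℝ (T y) y) '' {y | ‖y‖ = 1} with hA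
  have hbdd : BddAbove A := by
    refine ⟨‖T‖, ?_⟩
    rintro _ ⟨y, hy, rfl⟩
    have hy : ‖y‖ = 1 := hy
    calc inner ℝ (T y) y ≤ ‖T y‖ * ‖y‖ := real_inner_le_norm _ _
      _ ≤ (‖T‖ * ‖y‖) * ‖y‖ := by gcongr; exact T.le_opNorm _
      _ = ‖T‖ := by simp [hy]
  have hscale : ∀ y, inner ℝ (T y) y ≤ sSup A * ‖y‖ ^ 2 := by
    intro y
    rcases eq_or_ne y 0 with rfl | hy
    · simp
    have hy' : 0 < ‖y‖ := norm_pos_iff.2 hy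
    have hmem : inner ℝ (T (‖y‖⁻¹ • y)) (‖y‖⁻¹ • y) ∈ A :=
      ⟨_, by simp [norm_smul, hy'.ne'], rfl⟩
    have := le_csSup hbdd hmem
    simp only [map_smul, inner_smul_left, inner_smul_right, RCLike.conj_to_real] at this
    calc inner ℝ (T y) y = (‖y‖⁻¹ * (‖y‖⁻¹ * inner ℝ (T y) y)) * ‖y‖ ^ 2 := by field_simp
      _ ≤ _ := by gcongr
  rcases eq_or_ne x 0 with rfl | hx
  · simp
  have hne : A.Nonempty :=
    ⟨_, ‖x‖⁻¹ • x, by simp [norm_smul, (norm_pos_iff.2 hx).ne'], rfl⟩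
  have hspec : sSup A ∈ spectrum ℝ T := by
    intro hu
    set P := algebraMap ℝ (E →L[ℝ] E) (sSup A) - T with hPdef
    have hPsym := isSymmetric_smul_id_sub hT (sSup A)
    have hPin : ∀ y, inner ℝ (P y) y = sSup A * ‖y‖ ^ 2 - inner ℝ (T y) y := by
      intro y
      simp [hPdef, Algebra.algebraMap_eq_smul_one, inner_sub_left, inner_smul_left]
    have hPpos : ∀ y, 0 ≤ inner ℝ (P y) y := fun y => by
      rw [hPin]; linarith [hscale y]
    obtain ⟨u, hu⟩ := hu
    set Q : E →L[ℝ] E := ↑u⁻¹ with hQ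
    have hQP : ∀ y, Q (P y) = y := by
      intro y
      have : Q * P = 1 := by rw [hQ, hPdef, ← hu]; exact u.inv_mul
      calc Q (P y) = (Q * P) y := rfl
        _ = y := by rw [this]; rfl
    set K := ‖Q‖ ^ 2 * ‖P‖ + 1 with hK
    have hKpos : 0 < K := by positivity
    have hbound : ∀ y, ‖y‖ ^ 2 ≤ K * inner ℝ (P y) y := by
      intro y
      have h1 : ‖y‖ ≤ ‖Q‖ * ‖P y‖ := by
        conv_lhs => rw [← hQP y]
        exact Q.le_opNorm _
      calc ‖y‖ ^ 2 ≤ (‖Q‖ * ‖P y‖) ^ 2 := by gcongr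
        _ = ‖Q‖ ^ 2 * ‖P y‖ ^ 2 := by ring
        _ ≤ ‖Q‖ ^ 2 * (‖P‖ * inner ℝ (P y) y) := by
          gcongr; exact norm_sq_apply_le_of_nonneg hPsym hPpos y
        _ ≤ K * inner ℝ (P y) y := by
          have := hPpos y
          rw [hK]; nlinarith
    have : sSup A ≤ sSup A - K⁻¹ := by
      refine csSup_le hne ?_
      rintro _ ⟨y, hy, rfl⟩
      have hy : ‖y‖ = 1 := hy
      have := hbound y
      rw [hPin, hy] at this
      have h2 : K⁻¹ * 1 ≤ K⁻¹ * (K * (sSup A * 1 ^ 2 - inner ℝ (T y) y)) := by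
        gcongr; simpa using this
      rw [inv_mul_cancel_left₀ hKpos.ne'] at h2
      simp only
      linarith
    have : 0 < K⁻¹ := by positivity
    linarith
  have h1 : sSup A ≤ sSup (spectrum ℝ T) := le_csSup (spectrum.isBounded T).bddAbove hspec
  calc _ ≤ sSup A * ‖x‖ ^ 2 := hscale x
    _ ≤ _ := by gcongr

/-- If the form of `T` is bounded by `a` up to a finite-rank form, spectral values above `a` are
eigenvalues. -/
lemma exists_eigenvector_of_finite_rank_bound {W : Type*} [NormedAddCommGroup W] [NormedSpace ℝ W]
    [FiniteDimensional ℝ W] {T : E →L[ℝ] E} (hT : (T : E →ₗ[ℝ] E).IsSymmetric) (L : E →L[ℝ] W)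
    {a C : ℝ} (hC : 0 ≤ C) (hb : ∀ x, inner ℝ (T x) x ≤ a * ‖x‖ ^ 2 + C * ‖L x‖ ^ 2) {l : ℝ}
    (hl : l ∈ spectrum ℝ T) (hal : a < l) : ∃ x, ‖x‖ = 1 ∧ T x = l • x := by
  have := fun n : ℕ => exists_approx_eigenvector hT hl (Nat.one_div_pos_of_nat (α := ℝ) (n := n))
  choose u hu1 hu2 using this
  have : ProperSpace W := FiniteDimensional.proper ℝ W
  have hLb : ∀ n, L (u n) ∈ Metric.closedBall (0 : W) ‖L‖ := fun n => by
    simpa [hu1] using L.le_opNorm (u n)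
  obtain ⟨w, -, φ, hφ, hw⟩ := tendsto_subseq_of_bounded Metric.isBounded_closedBall hLb
  have hr : Tendsto (fun n => T (u n) - l • u n) atTop (𝓝 0) := by
    refine squeeze_zero_norm (fun n => (hu2 n).le) ?_
    exact tendsto_one_div_add_atTop_nhds_zero_nat
  have hcau : CauchySeq (u ∘ φ) := by
    rw [Metric.cauchySeq_iff']
    intro ε hε
    set η := (l - a) * ε ^ 2 with hη
    have hηpos : 0 < η := by have := sub_pos.2 hal; positivity
    have hc1 : CauchySeq (fun n => L (u (φ n))) := hw.cauchySeq
    obtain ⟨δ, hδ, hδC⟩ : ∃ δ > 0, C * δ ^ 2 < η / 2 := by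
      refine ⟨√(η / (4 * (C + 1))), by positivity, ?_⟩
      rw [Real.sq_sqrt (by positivity), ← mul_div_assoc, div_lt_div_iff₀ (by positivity) two_pos]
      nlinarith
    obtain ⟨N1, hN1⟩ := Metric.cauchySeq_iff.1 hc1 δ hδ
    have hr' := hr.comp hφ.tendsto_atTop
    obtain ⟨N2, hN2⟩ := Metric.tendsto_atTop.1 hr' (η / 8) (by positivity)
    refine ⟨max N1 N2, fun n hn => ?_⟩
    set m := max N1 N2
    set g := u (φ n) - u (φ m) with hg
    have hgn : ‖g‖ ≤ 2 := by
      calc ‖g‖ ≤ ‖u (φ n)‖ + ‖u (φ m)‖ := norm_sub_le _ _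
        _ = 2 := by rw [hu1, hu1]; norm_num
    have h1 : ‖L g‖ < δ := by
      have := hN1 n (le_trans (le_max_left _ _) hn) m (le_max_left _ _)
      rwa [dist_eq_norm, ← map_sub] at this
    have h2 : ‖T g - l • g‖ ≤ η / 4 := by
      have e1 := hN2 n (le_trans (le_max_right _ _) hn)
      have e2 := hN2 m (le_max_right _ _)
      simp only [Function.comp, dist_zero_right] at e1 e2
      have : T g - l • g = (T (u (φ n)) - l • u (φ n)) - (T (u (φ m)) - l • u (φ m)) := by
        rw [hg, map_sub, smul_sub]; abel
      rw [this]
      linarith [norm_sub_le (T (u (φ n)) - l • u (φ n)) (T (u (φ m)) - l • u (φ m))]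
    have h3 : inner ℝ (T g) g = l * ‖g‖ ^ 2 + inner ℝ (T g - l • g) g := by
      rw [inner_sub_left, inner_smul_left, real_inner_self_eq_norm_sq]; simp
    have h4 : -(η / 2) ≤ inner ℝ (T g - l • g) g := by
      have := abs_real_inner_le_norm (T g - l • g) g
      have h5 : ‖T g - l • g‖ * ‖g‖ ≤ η / 4 * 2 := by gcongr
      linarith [neg_abs_le (inner ℝ (T g - l • g) g)]
    have h6 := hb g
    have h7 : C * ‖L g‖ ^ 2 ≤ C * δ ^ 2 := by gcongr
    have h8 : (l - a) * ‖g‖ ^ 2 < (l - a) * ε ^ 2 := by rw [← hη]; linarith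
    have h9 : ‖g‖ ^ 2 < ε ^ 2 := lt_of_mul_lt_mul_left h8 (sub_pos.2 hal).le
    rw [Function.comp, Function.comp, dist_eq_norm]
    exact lt_of_pow_lt_pow_left₀ 2 hε.le h9
  obtain ⟨x, hx⟩ := cauchySeq_tendsto_of_complete hcau
  refine ⟨x, ?_, ?_⟩
  · refine tendsto_nhds_unique hx.norm ?_
    simp [Function.comp, hu1]
  · have h1 : Tendsto (fun n => T (u (φ n)) - l • u (φ n)) atTop (𝓝 (T x - l • x)) :=
      ((T.continuous.tendsto x).comp hx).sub (hx.const_smul l)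
    exact sub_eq_zero.1 (tendsto_nhds_unique h1 (hr.comp hφ.tendsto_atTop))

/-- If the form of `T` is bounded by `a` up to a finite-rank form, the spectrum above any `b > a`
is finite. -/
lemma finite_spectrum_inter_Ici_of_finite_rank_bound {W : Type*} [NormedAddCommGroup W]
    [NormedSpace ℝ W] [FiniteDimensional ℝ W] {T : E →L[ℝ] E}
    (hT : (T : E →ₗ[ℝ] E).IsSymmetric) (L : E →L[ℝ] W) {a C : ℝ} (hC : 0 ≤ C)
    (hb : ∀ x, inner ℝ (T x) x ≤ a * ‖x‖ ^ 2 + C * ‖L x‖ ^ 2) {b : ℝ} (hab : a < b) :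
    (spectrum ℝ T ∩ Set.Ici b).Finite := by
  by_contra hinf
  have : ProperSpace W := FiniteDimensional.proper ℝ W
  have hinf : (spectrum ℝ T ∩ Set.Ici b).Infinite := hinf
  set s := hinf.natEmbedding with hs
  have := fun n => exists_eigenvector_of_finite_rank_bound hT L hC hb (s n).2.1
    (hab.trans_le (s n).2.2)
  choose u hu1 hu2 using this
  have horth : ∀ m n, m ≠ n → inner ℝ (u m) (u n) = 0 := by
    intro m n hmn
    have h1 := hT (u m) (u n)
    simp only [ContinuousLinearMap.coe_coe, hu2, inner_smul_left, inner_smul_right,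
      RCLike.conj_to_real] at h1
    have h2 : ((s m : ℝ) - s n) ≠ 0 :=
      sub_ne_zero.2 fun h => hmn (s.injective (Subtype.ext h))
    have h3 : ((s m : ℝ) - s n) * inner ℝ (u m) (u n) = 0 := by linarith
    exact (mul_eq_zero.1 h3).resolve_left h2
  have hLb : ∀ n, L (u n) ∈ Metric.closedBall (0 : W) ‖L‖ := fun n => by
    simpa [hu1] using L.le_opNorm (u n)
  obtain ⟨w, -, φ, hφ, hw⟩ := tendsto_subseq_of_bounded Metric.isBounded_closedBall hLb
  have hc1 : CauchySeq (fun n => L (u (φ n))) := hw.cauchySeq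
  obtain ⟨δ, hδ, hδC⟩ : ∃ δ > 0, C * δ ^ 2 < b - a := by
    have := sub_pos.2 hab
    refine ⟨√((b - a) / (2 * (C + 1))), by positivity, ?_⟩
    rw [Real.sq_sqrt (by positivity), ← mul_div_assoc, div_lt_iff₀ (by positivity)]
    nlinarith
  obtain ⟨N, hN⟩ := Metric.cauchySeq_iff.1 hc1 δ hδ
  have hne : φ N ≠ φ (N + 1) := fun h => by simpa using hφ.injective h
  set g := u (φ N) - u (φ (N + 1)) with hg
  have h1 : ‖L g‖ < δ := by
    have := hN N le_rfl (N + 1) (Nat.le_succ N)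
    rwa [dist_eq_norm, ← map_sub] at this
  have ho := horth _ _ hne
  have ho' := horth _ _ hne.symm
  have h2 : ‖g‖ ^ 2 = 2 := by
    rw [← real_inner_self_eq_norm_sq, hg]
    simp only [inner_sub_left, inner_sub_right, ho, ho', real_inner_self_eq_norm_sq, hu1]
    norm_num
  have h3 : inner ℝ (T g) g = (s (φ N) : ℝ) + s (φ (N + 1)) := by
    rw [hg, map_sub, hu2, hu2]
    simp only [inner_sub_left, inner_sub_right, inner_smul_left, ho, ho',
      real_inner_self_eq_norm_sq, hu1, RCLike.conj_to_real]
    ring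
  have h4 := hb g
  have h5 : C * ‖L g‖ ^ 2 ≤ C * δ ^ 2 := by gcongr
  have h6 : b ≤ s (φ N) := (s (φ N)).2.2
  have h7 : b ≤ s (φ (N + 1)) := (s (φ (N + 1))).2.2
  rw [h2, h3] at h4
  linarith

end Abstract

/-- A point of the spectrum lying above a finite-rank form bound is isolated. -/
lemma exists_spectrum_inter_Ioo_eq_singleton {E W : Type*} [NormedAddCommGroup E]
    [InnerProductSpace ℝ E] [CompleteSpace E] [NormedAddCommGroup W] [NormedSpace ℝ W]
    [FiniteDimensional ℝ W] {T : E →L[ℝ] E} (hT : (T : E →ₗ[ℝ] E).IsSymmetric) (R : E →L[ℝ] W)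
    {a C M : ℝ} (hC : 0 ≤ C) (hb : ∀ x, inner ℝ (T x) x ≤ a * ‖x‖ ^ 2 + C * ‖R x‖ ^ 2)
    (haM : a < M) (hM : M ∈ spectrum ℝ T) :
    ∃ ε : ℝ, 0 < ε ∧ spectrum ℝ T ∩ Set.Ioo (M - ε) (M + ε) = {M} := by
  have hfin := finite_spectrum_inter_Ici_of_finite_rank_bound hT R hC hb
    (by linarith : a < (a + M) / 2)
  have hnhds : ((spectrum ℝ T ∩ Set.Ici ((a + M) / 2)) \ {M})ᶜ ∈ 𝓝 M :=
    (hfin.subset Set.sdiff_subset).isClosed.isOpen_compl.mem_nhds (by simp)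
  obtain ⟨ε, hε, hball⟩ := Metric.mem_nhds_iff.1 hnhds
  have hpos : 0 < min ε ((M - a) / 2) := lt_min hε (by linarith)
  refine ⟨min ε ((M - a) / 2), hpos, Set.Subset.antisymm ?_ ?_⟩
  · rintro l ⟨hl, hl1, hl2⟩
    by_contra hne
    have h1 := min_le_left ε ((M - a) / 2)
    have h2 := min_le_right ε ((M - a) / 2)
    have hlb : l ∈ Metric.ball M ε := by
      rw [Real.ball_eq_Ioo]
      constructor <;> linarith
    have hla : l ∈ Set.Ici ((a + M) / 2) := by
      rw [Set.mem_Ici]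
      linarith
    exact hball hlb ⟨⟨hl, hla⟩, hne⟩
  · rintro _ rfl
    exact ⟨hM, by linarith, by linarith⟩

/-- An eigenvalue with an eigenvector in an invariant subspace is in the spectrum of the
restriction. -/
lemma mem_spectrum_restrict {E : Type*} [NormedAddCommGroup E] [NormedSpace ℝ E]
    {T : E →L[ℝ] E} {S : Submodule ℝ E} {TS : S →L[ℝ] S} (hTS : ∀ v : S, (TS v : E) = T v)
    {M : ℝ} {g : E} (hg : g ∈ S) (hg0 : g ≠ 0) (hTg : T g = M • g) : M ∈ spectrum ℝ TS := by
  intro hu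
  have hv : (algebraMap ℝ (S →L[ℝ] S) M - TS) ⟨g, hg⟩ = 0 := by
    apply Subtype.ext
    simp [Algebra.algebraMap_eq_smul_one, hTS, hTg]
  obtain ⟨u, hu⟩ := hu
  have h : ((↑u⁻¹ : S →L[ℝ] S) * ↑u) ⟨g, hg⟩ = 0 := by
    change (↑u⁻¹ : S →L[ℝ] S) ((↑u : S →L[ℝ] S) ⟨g, hg⟩) = 0
    rw [hu, hv, map_zero]
  rw [u.inv_mul] at h
  exact hg0 (congrArg Subtype.val h)

section SquareSummable

variable {α : Type*} {f g : α → ℝ}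

lemma summable_mul_of_sq (hf : Summable fun a => f a ^ 2) (hg : Summable fun a => g a ^ 2) :
    Summable fun a => f a * g a := by
  refine Summable.of_norm_bounded (hf.add hg) fun a => ?_
  rw [Real.norm_eq_abs, abs_le]
  constructor <;> nlinarith [sq_nonneg (f a + g a), sq_nonneg (f a - g a), sq_nonneg (f a)]

lemma summable_sq_sub (hf : Summable fun a => f a ^ 2) (hg : Summable fun a => g a ^ 2) :
    Summable fun a => (f a - g a) ^ 2 := by
  refine ((hf.add hg).sub ((summable_mul_of_sq hf hg).mul_left 2)).congr fun a => ?_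
  ring

lemma memℓp_two_iff : Memℓp (E := fun _ : α => ℝ) f 2 ↔ Summable fun a => f a ^ 2 := by
  rw [memℓp_gen_iff (by norm_num)]
  simp

/-- The element of `ℓ²` given by a square-summable function. -/
def toL2 (f : α → ℝ) (hf : Summable fun a => f a ^ 2) : lp (fun _ : α => ℝ) 2 :=
  ⟨f, memℓp_two_iff.2 hf⟩

@[simp] lemma toL2_apply (hf : Summable fun a => f a ^ 2) (a : α) : toL2 f hf a = f a := rfl

lemma summable_sq_coe (f : lp (fun _ : α => ℝ) 2) : Summable fun a => f a ^ 2 :=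
  memℓp_two_iff.1 f.2

lemma norm_sq_eq_tsum_sq (f : lp (fun _ : α => ℝ) 2) : ‖f‖ ^ 2 = ∑' a, f a ^ 2 := by
  rw [← real_inner_self_eq_norm_sq, lp.inner_eq_tsum]
  simp

lemma sq_sqrt_sub_sqrt_le (hf : Summable fun a => f a ^ 2) (hg : Summable fun a => g a ^ 2) :
    (√(∑' a, f a ^ 2) - √(∑' a, g a ^ 2)) ^ 2 ≤ ∑' a, (f a - g a) ^ 2 := by
  have h1 : ‖toL2 f hf‖ = √(∑' a, f a ^ 2) := by
    rw [← Real.sqrt_sq (norm_nonneg (toL2 f hf)), norm_sq_eq_tsum_sq]; simp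
  have h2 : ‖toL2 g hg‖ = √(∑' a, g a ^ 2) := by
    rw [← Real.sqrt_sq (norm_nonneg (toL2 g hg)), norm_sq_eq_tsum_sq]; simp
  have h3 : ‖toL2 f hf - toL2 g hg‖ ^ 2 = ∑' a, (f a - g a) ^ 2 := by
    rw [norm_sq_eq_tsum_sq]; simp
  rw [← h1, ← h2, ← h3, sq_le_sq, abs_norm]
  exact abs_norm_sub_norm_le _ _

lemma summable_bounded_mul_sq {w : α → ℝ} {C : ℝ} (hw0 : ∀ q, 0 ≤ w q) (hw : ∀ q, w q ≤ C)
    (hf : Summable fun q => f q ^ 2) : Summable fun q => w q * f q ^ 2 :=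
  Summable.of_nonneg_of_le (fun q => mul_nonneg (hw0 q) (sq_nonneg _))
    (fun q => mul_le_mul_of_nonneg_right (hw q) (sq_nonneg _)) (hf.mul_left C)

lemma summable_mul_sq_left {c s : α → ℝ} (h : ∀ q, c q ^ 2 + s q ^ 2 = 1)
    (hf : Summable fun q => f q ^ 2) :
    Summable fun q => (c q * f q) ^ 2 := by
  simpa only [mul_pow] using summable_bounded_mul_sq (w := fun q => c q ^ 2) (C := 1)
    (fun q => sq_nonneg _) (fun q => by nlinarith [h q, sq_nonneg (s q)]) hf

end SquareSummable

section Energy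

variable {G : Type*} [AddCommGroup G]

lemma summable_add_right {u : G → ℝ} (hu : Summable u) (e : G) : Summable fun q => u (q + e) :=
  (Equiv.addRight e).summable_iff.2 hu

lemma tsum_add_right (u : G → ℝ) (e : G) : ∑' q, u (q + e) = ∑' q, u q :=
  (Equiv.addRight e).tsum_eq u

/-- The Dirichlet form of the translation by `e`, as a bilinear form. -/
noncomputable def dirichlet (e : G) (f g : G → ℝ) : ℝ :=
  ∑' q, (f (q + e) - f q) * (g (q + e) - g q)

/-- The Dirichlet energy of the translation by `e`. -/
noncomputable def energy (e : G) (f : G → ℝ) : ℝ := ∑' q, (f (q + e) - f q) ^ 2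

lemma dirichlet_self (e : G) (f : G → ℝ) : dirichlet e f f = energy e f :=
  tsum_congr fun _ => by ring

lemma dirichlet_comm (e : G) (f g : G → ℝ) : dirichlet e f g = dirichlet e g f :=
  tsum_congr fun _ => by ring

lemma energy_nonneg (e : G) (f : G → ℝ) : 0 ≤ energy e f := tsum_nonneg fun _ => sq_nonneg _

variable {f g : G → ℝ}

lemma summable_energy (hf : Summable fun q => f q ^ 2) (e : G) :
    Summable fun q => (f (q + e) - f q) ^ 2 :=
  summable_sq_sub (f := fun q => f (q + e)) (summable_add_right hf e) hf

lemma energy_eq (hf : Summable fun q => f q ^ 2) (e : G) :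
    energy e f = 2 * ∑' q, f q ^ 2 - 2 * ∑' q, f (q + e) * f q := by
  have h1 := summable_add_right hf e
  have h2 := summable_mul_of_sq (f := fun q => f (q + e)) h1 hf
  have h3 : ∑' q, f (q + e) ^ 2 = ∑' q, f q ^ 2 := tsum_add_right (fun q => f q ^ 2) e
  rw [energy, two_mul (∑' q, f q ^ 2)]
  nth_rw 1 [← h3]
  rw [← tsum_mul_left, ← h1.tsum_add hf, ← (h1.add hf).tsum_sub (h2.mul_left 2)]
  exact tsum_congr fun _ => by ring

lemma hasSum_laplace (hf : Summable fun q => f q ^ 2) (hg : Summable fun q => g q ^ 2) (e : G) :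
    HasSum (fun q => ((f (q + e) - f q) + (f (q - e) - f q)) * g q) (-dirichlet e f g) := by
  have hfe := summable_sq_sub (f := fun q => f (q + e)) (summable_add_right hf e) hf
  have h1 : Summable fun q => (f (q + e) - f q) * g q :=
    summable_mul_of_sq (f := fun q => f (q + e) - f q) hfe hg
  have h2 : Summable fun q => (f (q + e) - f q) * g (q + e) :=
    summable_mul_of_sq (f := fun q => f (q + e) - f q) hfe (summable_add_right hg e)
  have h3 : HasSum (fun q => (f q - f (q - e)) * g q)
      (∑' q, (f (q + e) - f q) * g (q + e)) := by
    rw [← (Equiv.addRight e).hasSum_iff]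
    simpa [Function.comp_def] using h2.hasSum
  have h4 : -dirichlet e f g =
      ∑' q, (f (q + e) - f q) * g q - ∑' q, (f (q + e) - f q) * g (q + e) := by
    rw [dirichlet, ← h1.tsum_sub h2, ← tsum_neg]
    exact tsum_congr fun _ => by ring
  rw [h4]
  refine (h1.hasSum.sub h3).congr_fun fun q => ?_
  ring

lemma energy_abs_le (hf : Summable fun q => f q ^ 2) (e : G) :
    energy e (fun q => |f q|) ≤ energy e f := by
  have hf' : Summable fun q => |f q| ^ 2 := by simpa only [sq_abs] using hf
  refine (summable_energy hf' e).tsum_le_tsum (fun q => ?_) (summable_energy hf e)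
  exact sq_le_sq.2 (abs_abs_sub_abs_le (f (q + e)) (f q))

end Energy

section Product

variable {G₁ G₂ : Type*} {f : G₁ × G₂ → ℝ}

lemma summable_sq_swap (hf : Summable fun q => f q ^ 2) :
    Summable fun q : G₂ × G₁ => f q.swap ^ 2 :=
  (Equiv.prodComm G₂ G₁).summable_iff.2 hf

/-- The `ℓ²`-norm of a function on a product in the second variable. -/
noncomputable def fiberNorm (f : G₁ × G₂ → ℝ) (x : G₁) : ℝ := √(∑' y, f (x, y) ^ 2)

lemma fiberNorm_sq (f : G₁ × G₂ → ℝ) (x : G₁) : fiberNorm f x ^ 2 = ∑' y, f (x, y) ^ 2 :=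
  Real.sq_sqrt (tsum_nonneg fun _ => sq_nonneg _)

lemma summable_fiberNorm_sq (hf : Summable fun q => f q ^ 2) :
    Summable fun x => fiberNorm f x ^ 2 := by
  simp only [fiberNorm_sq]
  exact hf.prod

lemma tsum_fiberNorm_sq (hf : Summable fun q => f q ^ 2) :
    ∑' x, fiberNorm f x ^ 2 = ∑' q, f q ^ 2 := by
  simp only [fiberNorm_sq]
  exact hf.tsum_prod.symm

variable {u : G₁ → ℝ} {v : G₂ → ℝ}

lemma hasSum_tensor (hu : Summable u) (hv : Summable v) :
    HasSum (fun q : G₁ × G₂ => u q.1 * v q.2) ((∑' x, u x) * ∑' y, v y) := by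
  have hs : Summable fun q : G₁ × G₂ => u q.1 * v q.2 :=
    summable_mul_of_summable_norm (f := u) (g := v) hu.norm hv.norm
  rw [hu.tsum_mul_tsum hv hs]
  exact hs.hasSum

lemma summable_tensor_sq (hu : Summable fun x => u x ^ 2) (hv : Summable fun y => v y ^ 2) :
    Summable fun q : G₁ × G₂ => (u q.1 * v q.2) ^ 2 := by
  simpa only [mul_pow] using (hasSum_tensor hu hv).summable

variable [AddCommGroup G₁] [AddCommGroup G₂]

lemma energy_comp_swap (a : G₁) (b : G₂) (f : G₁ × G₂ → ℝ) :
    energy (b, a) (fun q => f q.swap) = energy (a, b) f :=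
  (Equiv.prodComm G₂ G₁).tsum_eq (fun q => (f (q + (a, b)) - f q) ^ 2)

lemma energy_fiberNorm_le (hf : Summable fun q => f q ^ 2) (a : G₁) (b : G₂) :
    energy a (fiberNorm f) ≤ energy (a, b) f := by
  have hs := summable_energy hf (a, b)
  rw [energy, energy, hs.tsum_prod]
  refine Summable.tsum_le_tsum (fun x => ?_) (summable_energy (summable_fiberNorm_sq hf) a) hs.prod
  have h1 : fiberNorm f (x + a) = √(∑' y, f (x + a, y + b) ^ 2) := by
    rw [fiberNorm, ← tsum_add_right _ b]
  rw [h1]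
  exact sq_sqrt_sub_sqrt_le (f := fun y => f (x + a, y + b)) (g := fun y => f (x, y))
    (summable_add_right (hf.prod_factor (x + a)) b) (hf.prod_factor x)

lemma energy_tensor (hu : Summable fun x => u x ^ 2) (hv : Summable fun y => v y ^ 2)
    (a : G₁) (b : G₂) :
    energy (a, b) (fun q => u q.1 * v q.2) =
      2 * ((∑' x, u x ^ 2) * ∑' y, v y ^ 2)
        - 2 * ((∑' x, u (x + a) * u x) * ∑' y, v (y + b) * v y) := by
  rw [energy_eq (summable_tensor_sq hu hv)]
  have h1 := (hasSum_tensor hu hv).tsum_eq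
  have h2 := (hasSum_tensor
    (summable_mul_of_sq (f := fun x => u (x + a)) (summable_add_right hu a) hu)
    (summable_mul_of_sq (f := fun y => v (y + b)) (summable_add_right hv b) hv)).tsum_eq
  rw [← h1, ← h2]
  congr 2
  · exact tsum_congr fun q => by ring
  · exact tsum_congr fun q => by simp only [Prod.fst_add, Prod.snd_add]; ring

end Product

section Localization

variable {G : Type*} [AddCommGroup G] {f c s : G → ℝ}

/-- The squared increment of the pair `(c, s)` along `e`. -/
def incrSq (c s : G → ℝ) (e q : G) : ℝ := (c (q + e) - c q) ^ 2 + (s (q + e) - s q) ^ 2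

/-- The localization error of the pair `(c, s)` along `e`. -/
noncomputable def locError (c s : G → ℝ) (e q : G) : ℝ :=
  (incrSq c s e q + incrSq c s e (q - e)) / 2

lemma incrSq_nonneg (c s : G → ℝ) (e q : G) : 0 ≤ incrSq c s e q := by
  unfold incrSq; positivity

lemma incrSq_le (h : ∀ q, c q ^ 2 + s q ^ 2 = 1) (e q : G) : incrSq c s e q ≤ 4 := by
  unfold incrSq
  nlinarith [h q, h (q + e), sq_nonneg (c (q + e) + c q), sq_nonneg (s (q + e) + s q)]

lemma locError_nonneg (c s : G → ℝ) (e q : G) : 0 ≤ locError c s e q := by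
  have := incrSq_nonneg c s e q
  have := incrSq_nonneg c s e (q - e)
  unfold locError; positivity

lemma locError_le (h : ∀ q, c q ^ 2 + s q ^ 2 = 1) (e q : G) : locError c s e q ≤ 4 := by
  have := incrSq_le h e q
  have := incrSq_le h e (q - e)
  unfold locError; linarith

/-- IMS localization formula for the Dirichlet energy. -/
lemma energy_localization (h : ∀ q, c q ^ 2 + s q ^ 2 = 1) (hf : Summable fun q => f q ^ 2)
    (e : G) :
    energy e (fun q => c q * f q) + energy e (fun q => s q * f q) ≤
      energy e f + ∑' q, locError c s e q * f q ^ 2 := by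
  have h' : ∀ q, s q ^ 2 + c q ^ 2 = 1 := fun q => by rw [add_comm]; exact h q
  have hc := summable_energy (summable_mul_sq_left h hf) e
  have hs := summable_energy (summable_mul_sq_left h' hf) e
  have he := summable_energy hf e
  have hw : Summable fun q => incrSq c s e q * f q ^ 2 :=
    summable_bounded_mul_sq (incrSq_nonneg c s e) (incrSq_le h e) hf
  have hw' : Summable fun q => incrSq c s e (q - e) * f q ^ 2 :=
    summable_bounded_mul_sq (fun q => incrSq_nonneg c s e (q - e))
      (fun q => incrSq_le h e (q - e)) hf
  have hw2 : Summable fun q => incrSq c s e q * f (q + e) ^ 2 := by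
    simpa using summable_add_right hw' e
  have hw3 : ∑' q, incrSq c s e q * f (q + e) ^ 2 = ∑' q, incrSq c s e (q - e) * f q ^ 2 := by
    simpa using tsum_add_right (fun q => incrSq c s e (q - e) * f q ^ 2) e
  have h1 : ∑' q, locError c s e q * f q ^ 2 =
      ∑' q, (incrSq c s e q * f q ^ 2 + incrSq c s e q * f (q + e) ^ 2) / 2 := by
    rw [tsum_div_const, hw.tsum_add hw2, hw3, ← hw.tsum_add hw', ← tsum_div_const]
    exact tsum_congr fun q => by unfold locError; ring
  rw [h1, energy, energy, energy, ← hc.tsum_add hs, ← he.tsum_add ((hw.add hw2).div_const 2)]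
  refine Summable.tsum_le_tsum (fun q => ?_) (hc.add hs) (he.add ((hw.add hw2).div_const 2))
  have key : (c (q + e) * f (q + e) - c q * f q) ^ 2 + (s (q + e) * f (q + e) - s q * f q) ^ 2 =
      (f (q + e) - f q) ^ 2 + incrSq c s e q * (f q * f (q + e)) := by
    have e1 : c q ^ 2 = 1 - s q ^ 2 := by linarith [h q]
    have e2 : c (q + e) ^ 2 = 1 - s (q + e) ^ 2 := by linarith [h (q + e)]
    unfold incrSq
    linear_combination (f q ^ 2 - f q * f (q + e)) * h q +
      (f (q + e) ^ 2 - f q * f (q + e)) * h (q + e)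
  rw [key]
  nlinarith [incrSq_nonneg c s e q,
    mul_nonneg (incrSq_nonneg c s e q) (sq_nonneg (f q - f (q + e)))]

end Localization

section Partition

lemma norm_normalize_sub_le {V : Type*} [NormedAddCommGroup V] [NormedSpace ℝ V] {a b : V}
    (ha : a ≠ 0) (hb : b ≠ 0) : ‖‖a‖⁻¹ • a - ‖b‖⁻¹ • b‖ ≤ 2 * ‖a - b‖ / ‖b‖ := by
  have ha' : 0 < ‖a‖ := norm_pos_iff.2 ha
  have hb' : 0 < ‖b‖ := norm_pos_iff.2 hb
  have h1 : ‖a‖⁻¹ • a - ‖b‖⁻¹ • b = (‖a‖⁻¹ - ‖b‖⁻¹) • a + ‖b‖⁻¹ • (a - b) := by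
    rw [sub_smul, smul_sub]; abel
  have h2 : ‖(‖a‖⁻¹ - ‖b‖⁻¹) • a‖ = |‖b‖ - ‖a‖| / ‖b‖ := by
    rw [norm_smul, Real.norm_eq_abs, inv_sub_inv ha'.ne' hb'.ne', abs_div,
      abs_of_pos (mul_pos ha' hb')]
    field_simp
  have h3 : |‖b‖ - ‖a‖| ≤ ‖a - b‖ := by
    rw [abs_sub_comm]; exact abs_norm_sub_norm_le a b
  calc _ ≤ ‖(‖a‖⁻¹ - ‖b‖⁻¹) • a‖ + ‖‖b‖⁻¹ • (a - b)‖ := by rw [h1]; exact norm_add_le _ _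
    _ = |‖b‖ - ‖a‖| / ‖b‖ + ‖a - b‖ / ‖b‖ := by
      rw [h2, norm_smul, norm_inv, norm_norm, inv_mul_eq_div]
    _ ≤ ‖a - b‖ / ‖b‖ + ‖a - b‖ / ‖b‖ := by gcongr
    _ = _ := by ring

variable {G : Type*} [NormedAddCommGroup G]

/-- The pair of norms of the components, in exchanged order, as a complex number. -/
def normPair (q : G × G) : ℂ := ⟨‖q.2‖, ‖q.1‖⟩

lemma norm_le_norm_normPair (q : G × G) : ‖q‖ ≤ ‖normPair q‖ := by
  rw [Prod.norm_def]
  refine max_le ?_ ?_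
  · simpa [normPair] using Complex.abs_im_le_norm (normPair q)
  · simpa [normPair] using Complex.abs_re_le_norm (normPair q)

lemma normPair_ne_zero {q : G × G} (hq : q ≠ 0) : normPair q ≠ 0 :=
  norm_pos_iff.1 ((norm_pos_iff.2 hq).trans_le (norm_le_norm_normPair q))

lemma norm_normPair_sub_le (q e : G × G) :
    ‖normPair (q + e) - normPair q‖ ≤ ‖e.2‖ + ‖e.1‖ := by
  refine (Complex.norm_le_abs_re_add_abs_im _).trans (add_le_add ?_ ?_)
  · simpa [normPair] using abs_norm_sub_norm_le (q.2 + e.2) q.2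
  · simpa [normPair] using abs_norm_sub_norm_le (q.1 + e.1) q.1

open Classical in
/-- The direction of `normPair`, with value `1` at the origin. -/
noncomputable def direction (q : G × G) : ℂ :=
  if q = 0 then 1 else ‖normPair q‖⁻¹ • normPair q

lemma norm_direction (q : G × G) : ‖direction q‖ = 1 := by
  unfold direction
  split_ifs with h
  · simp
  · rw [norm_smul, norm_inv, norm_norm,
      inv_mul_cancel₀ (norm_pos_iff.2 (normPair_ne_zero h)).ne']

lemma re_sq_add_im_sq_direction (q : G × G) : (direction q).re ^ 2 + (direction q).im ^ 2 = 1 := by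
  have := Complex.sq_norm (direction q)
  rw [norm_direction, Complex.normSq_apply] at this
  linarith

lemma re_direction_sq {q : G × G} (h1 : q.1 = 0) : (direction q).re ^ 2 = 1 := by
  have h : (direction q).im = 0 := by
    unfold direction
    split_ifs <;> simp [normPair, h1]
  simpa [h] using re_sq_add_im_sq_direction q

lemma im_direction_sq {q : G × G} (h1 : q.1 ≠ 0) (h2 : q.2 = 0) : (direction q).im ^ 2 = 1 := by
  have hq : q ≠ 0 := fun h => h1 (by rw [h]; rfl)
  have h : (direction q).re = 0 := by
    rw [direction, if_neg hq]
    simp [normPair, h2]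
  simpa [h] using re_sq_add_im_sq_direction q

lemma tendsto_incrSq_direction (hG : Tendsto (fun q : G × G => ‖q‖) cofinite atTop) (e : G × G) :
    Tendsto (incrSq (fun q => (direction q).re) (fun q => (direction q).im) e) cofinite (𝓝 0) := by
  have h1 : ∀ q, incrSq (fun q => (direction q).re) (fun q => (direction q).im) e q =
      ‖direction (q + e) - direction q‖ ^ 2 := by
    intro q
    rw [Complex.sq_norm, Complex.normSq_apply, Complex.sub_re, Complex.sub_im, incrSq]
    ring
  simp only [funext h1]
  have h2 : Tendsto (fun q : G × G => 2 * (‖e.2‖ + ‖e.1‖) / ‖q‖) cofinite (𝓝 0) :=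
    hG.const_div_atTop _
  have h3 : Tendsto (fun q => ‖direction (q + e) - direction q‖) cofinite (𝓝 0) := by
    refine squeeze_zero' (Eventually.of_forall fun _ => norm_nonneg _) ?_ h2
    have hfin : ({0, -e} : Set (G × G)).Finite := by simp
    filter_upwards [hfin.compl_mem_cofinite] with q hq
    simp only [Set.mem_compl_iff, Set.mem_insert_iff, Set.mem_singleton_iff, not_or] at hq
    have hq1 : q ≠ 0 := hq.1
    have hq2 : q + e ≠ 0 := fun h => hq.2 (eq_neg_of_add_eq_zero_left h)
    rw [direction, direction, if_neg hq1, if_neg hq2]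
    have hq' : 0 < ‖q‖ := norm_pos_iff.2 hq1
    calc _ ≤ 2 * ‖normPair (q + e) - normPair q‖ / ‖normPair q‖ :=
          norm_normalize_sub_le (normPair_ne_zero hq2) (normPair_ne_zero hq1)
      _ ≤ 2 * (‖e.2‖ + ‖e.1‖) / ‖q‖ := by
        gcongr
        · exact norm_normPair_sub_le q e
        · exact norm_le_norm_normPair q
  simpa using h3.pow 2

lemma tendsto_locError_direction (hG : Tendsto (fun q : G × G => ‖q‖) cofinite atTop)
    (e : G × G) :
    Tendsto (locError (fun q => (direction q).re) (fun q => (direction q).im) e)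
      cofinite (𝓝 0) := by
  have h1 := tendsto_incrSq_direction hG e
  have h2 := h1.comp (sub_left_injective (b := e)).tendsto_cofinite
  have h3 := (h1.add h2).div_const 2
  rw [add_zero, zero_div] at h3
  exact h3

end Partition

lemma tendsto_norm_cofinite_lattice (d : ℕ) :
    Tendsto (fun q : (Fin d → ℤ) × (Fin d → ℤ) => ‖q‖) cofinite atTop := by
  rw [← cocompact_eq_cofinite]
  exact tendsto_norm_cocompact_atTop

section Lattice

variable {d : ℕ} {κ ρ γ M : ℝ} {f g : (Fin d → ℤ) × (Fin d → ℤ) → ℝ}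

/-- The Dirichlet form of `-A²`, as a bilinear form. -/
noncomputable def kinetic (κ ρ : ℝ) (f g : (Fin d → ℤ) × (Fin d → ℤ) → ℝ) : ℝ :=
  κ * ∑ j : Fin d, (dirichlet (Pi.single j 1, 0) f g + dirichlet (0, Pi.single j 1) f g)
    + ρ * ∑ j : Fin d, dirichlet (Pi.single j 1, Pi.single j 1) f g

/-- The form of the indicator of `x₁ = 0`. -/
noncomputable def potFst (f g : (Fin d → ℤ) × (Fin d → ℤ) → ℝ) : ℝ :=
  ∑' q, (if q.1 = 0 then (1 : ℝ) else 0) * (f q * g q)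

/-- The form of the indicator of `x₂ = 0`. -/
noncomputable def potSnd (f g : (Fin d → ℤ) × (Fin d → ℤ) → ℝ) : ℝ :=
  ∑' q, (if q.2 = 0 then (1 : ℝ) else 0) * (f q * g q)

lemma summable_ite_mul {α : Type*} (p : α → Prop) [DecidablePred p] {u : α → ℝ}
    (hu : Summable u) : Summable fun q => (if p q then (1 : ℝ) else 0) * u q :=
  (hu.indicator {q | p q}).congr fun q => by by_cases h : p q <;> simp [h]

/-- The form of the one-particle operator is at most `M/2` if the form of the two-particle
operator is at most `M`: test the latter on tensor squares. -/
lemma one_particle_bound (hρ : 0 ≤ ρ)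
    (hM : ∀ f : (Fin d → ℤ) × (Fin d → ℤ) → ℝ, (Summable fun q => f q ^ 2) →
      -kinetic κ ρ f f + γ * (potFst f f + potSnd f f) ≤ M * ∑' q, f q ^ 2)
    {u : (Fin d → ℤ) → ℝ} (hu : Summable fun x => u x ^ 2) :
    -((κ + ρ) * ∑ j : Fin d, energy (Pi.single j 1) u) + γ * u 0 ^ 2 ≤
      M / 2 * ∑' x, u x ^ 2 := by
  set N := ∑' x, u x ^ 2 with hN
  have hN0 : 0 ≤ N := tsum_nonneg fun _ => sq_nonneg _
  have h1 := hM _ (summable_tensor_sq hu hu)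
  have hnorm : ∑' q : (Fin d → ℤ) × (Fin d → ℤ), (u q.1 * u q.2) ^ 2 = N * N := by
    simpa only [mul_pow] using (hasSum_tensor hu hu).tsum_eq
  have hind : ∑' x, (if x = 0 then (1 : ℝ) else 0) * u x ^ 2 = u 0 ^ 2 := by
    rw [tsum_eq_single 0 (fun x hx => by simp [hx])]; simp
  have hp1 : potFst (fun q : (Fin d → ℤ) × (Fin d → ℤ) => u q.1 * u q.2)
      (fun q => u q.1 * u q.2) = u 0 ^ 2 * N := by
    rw [← hind, hN, ← (hasSum_tensor (summable_ite_mul (fun x => x = 0) hu) hu).tsum_eq]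
    exact tsum_congr fun q => by ring
  have hp2 : potSnd (fun q : (Fin d → ℤ) × (Fin d → ℤ) => u q.1 * u q.2)
      (fun q => u q.1 * u q.2) = N * u 0 ^ 2 := by
    rw [← hind, hN, ← (hasSum_tensor hu (summable_ite_mul (fun x => x = 0) hu)).tsum_eq]
    exact tsum_congr fun q => by ring
  have hzero : ∑' x, u (x + 0) * u x = N := tsum_congr fun x => by rw [add_zero]; ring
  have hk1 : ∀ j : Fin d, dirichlet (Pi.single j 1, 0)
      (fun q : (Fin d → ℤ) × (Fin d → ℤ) => u q.1 * u q.2) (fun q => u q.1 * u q.2) =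
      N * energy (Pi.single j 1) u := fun j => by
    rw [dirichlet_self, energy_tensor hu hu, energy_eq hu, hzero]; ring
  have hk2 : ∀ j : Fin d, dirichlet (0, Pi.single j 1)
      (fun q : (Fin d → ℤ) × (Fin d → ℤ) => u q.1 * u q.2) (fun q => u q.1 * u q.2) =
      N * energy (Pi.single j 1) u := fun j => by
    rw [dirichlet_self, energy_tensor hu hu, energy_eq hu, hzero]; ring
  have hk3 : ∀ j : Fin d, dirichlet (Pi.single j 1, Pi.single j 1)
      (fun q : (Fin d → ℤ) × (Fin d → ℤ) => u q.1 * u q.2) (fun q => u q.1 * u q.2) ≤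
      2 * N * energy (Pi.single j 1) u := fun j => by
    rw [dirichlet_self, energy_tensor hu hu, energy_eq hu]
    nlinarith [sq_nonneg (N - ∑' x, u (x + Pi.single j 1) * u x)]
  have hk : kinetic κ ρ (fun q : (Fin d → ℤ) × (Fin d → ℤ) => u q.1 * u q.2)
      (fun q => u q.1 * u q.2) ≤
      2 * N * ((κ + ρ) * ∑ j : Fin d, energy (Pi.single j 1) u) := by
    have h3 := Finset.sum_le_sum fun j (_ : j ∈ Finset.univ) => hk3 j
    rw [← Finset.mul_sum] at h3
    have h4 := mul_le_mul_of_nonneg_left h3 hρ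
    have h5 : ∑ j : Fin d, (N * energy (Pi.single j 1) u + N * energy (Pi.single j 1) u) =
        2 * N * ∑ j : Fin d, energy (Pi.single j 1) u := by
      rw [Finset.mul_sum]; exact Finset.sum_congr rfl fun j _ => by ring
    simp only [kinetic, hk1, hk2, h5]
    linarith
  rw [hnorm, hp1, hp2] at h1
  rcases hN0.eq_or_lt with h0 | hpos
  · have hu0 : ∀ x, u x = 0 := by
      have h6 := (hasSum_zero_iff_of_nonneg fun x => sq_nonneg (u x)).1 (by
        have := hu.hasSum
        rwa [← hN, ← h0] at this)
      intro x
      simpa using congrFun h6 x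
    simp [← h0, hu0, energy]
  · have h7 : N * (-((κ + ρ) * ∑ j : Fin d, energy (Pi.single j 1) u) + γ * u 0 ^ 2) ≤
        N * (M / 2 * N) := by linarith
    exact le_of_mul_le_mul_left h7 hpos

lemma kinetic_comp_swap (f : (Fin d → ℤ) × (Fin d → ℤ) → ℝ) :
    kinetic κ ρ (fun q => f q.swap) (fun q => f q.swap) = kinetic κ ρ f f := by
  simp only [kinetic, dirichlet_self, energy_comp_swap]
  simp only [add_comm]

lemma potFst_comp_swap (f : (Fin d → ℤ) × (Fin d → ℤ) → ℝ) :
    potFst (fun q => f q.swap) (fun q => f q.swap) = potSnd f f :=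
  (Equiv.prodComm (Fin d → ℤ) (Fin d → ℤ)).tsum_eq
    fun q => (if q.2 = 0 then (1 : ℝ) else 0) * (f q * f q)

lemma potSnd_comp_swap (f : (Fin d → ℤ) × (Fin d → ℤ) → ℝ) :
    potSnd (fun q => f q.swap) (fun q => f q.swap) = potFst f f :=
  (Equiv.prodComm (Fin d → ℤ) (Fin d → ℤ)).tsum_eq
    fun q => (if q.1 = 0 then (1 : ℝ) else 0) * (f q * f q)

/-- A one-particle form bound passes to the two-particle form with one potential. -/
lemma potFst_bound (hκ : 0 ≤ κ) (hρ : 0 ≤ ρ) {m : ℝ}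
    (hm : ∀ u : (Fin d → ℤ) → ℝ, (Summable fun x => u x ^ 2) →
      -((κ + ρ) * ∑ j : Fin d, energy (Pi.single j 1) u) + γ * u 0 ^ 2 ≤ m * ∑' x, u x ^ 2)
    (hf : Summable fun q => f q ^ 2) :
    -kinetic κ ρ f f + γ * potFst f f ≤ m * ∑' q, f q ^ 2 := by
  have h1 := hm _ (summable_fiberNorm_sq hf)
  rw [tsum_fiberNorm_sq hf] at h1
  have hp : potFst f f = fiberNorm f 0 ^ 2 := by
    have hs := summable_ite_mul (fun q : (Fin d → ℤ) × (Fin d → ℤ) => q.1 = 0)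
      (summable_mul_of_sq hf hf)
    rw [potFst, hs.tsum_prod, tsum_eq_single 0 (fun x hx => by simp [hx]), fiberNorm_sq]
    exact tsum_congr fun y => by simp; ring
  have hk : (κ + ρ) * ∑ j : Fin d, energy (Pi.single j 1) (fiberNorm f) ≤ kinetic κ ρ f f := by
    simp only [kinetic, dirichlet_self]
    rw [add_mul]
    gcongr with j _ j _
    · exact (energy_fiberNorm_le hf _ 0).trans (le_add_of_nonneg_right (energy_nonneg _ _))
    · exact energy_fiberNorm_le hf _ _
  rw [hp]
  linarith

lemma potSnd_bound (hκ : 0 ≤ κ) (hρ : 0 ≤ ρ) {m : ℝ}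
    (hm : ∀ u : (Fin d → ℤ) → ℝ, (Summable fun x => u x ^ 2) →
      -((κ + ρ) * ∑ j : Fin d, energy (Pi.single j 1) u) + γ * u 0 ^ 2 ≤ m * ∑' x, u x ^ 2)
    (hf : Summable fun q => f q ^ 2) :
    -kinetic κ ρ f f + γ * potSnd f f ≤ m * ∑' q, f q ^ 2 := by
  have h := potFst_bound hκ hρ hm (summable_sq_swap hf)
  have hs : ∑' q : (Fin d → ℤ) × (Fin d → ℤ), f q.swap ^ 2 = ∑' q, f q ^ 2 :=
    (Equiv.prodComm (Fin d → ℤ) (Fin d → ℤ)).tsum_eq fun q => f q ^ 2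
  rwa [kinetic_comp_swap, potFst_comp_swap, hs] at h

/-- The total localization error of the partition `direction`. -/
noncomputable def errorWeight (κ ρ γ : ℝ) (q : (Fin d → ℤ) × (Fin d → ℤ)) : ℝ :=
  let w := fun e : (Fin d → ℤ) × (Fin d → ℤ) =>
    locError (fun q => (direction q).re) (fun q => (direction q).im) e q
  κ * ∑ j : Fin d, (w (Pi.single j 1, 0) + w (0, Pi.single j 1))
    + ρ * ∑ j : Fin d, w (Pi.single j 1, Pi.single j 1) + γ * (if q = 0 then 1 else 0)

lemma tendsto_errorWeight (κ ρ γ : ℝ) :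
    Tendsto (errorWeight (d := d) κ ρ γ) cofinite (𝓝 0) := by
  have h := tendsto_locError_direction (tendsto_norm_cofinite_lattice d)
  have h0 : Tendsto (fun q : (Fin d → ℤ) × (Fin d → ℤ) => if q = 0 then (1 : ℝ) else 0)
      cofinite (𝓝 0) := by
    refine tendsto_const_nhds.congr' ?_
    filter_upwards [(Set.finite_singleton (0 : (Fin d → ℤ) × (Fin d → ℤ))).compl_mem_cofinite]
      with q hq
    rw [if_neg (by simpa using hq)]
  have h1 := ((tendsto_finsetSum (x := cofinite) Finset.univ fun (j : Fin d) _ =>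
    (h (Pi.single j 1, 0)).add (h (0, Pi.single j 1))).const_mul κ).add
    ((tendsto_finsetSum (x := cofinite) Finset.univ fun (j : Fin d) _ =>
      (h (Pi.single j 1, Pi.single j 1))).const_mul ρ)
  have h2 := h1.add (h0.const_mul γ)
  simp only [add_zero, Finset.sum_const_zero, mul_zero] at h2
  exact h2

lemma errorWeight_nonneg (hκ : 0 ≤ κ) (hρ : 0 ≤ ρ) (hγ : 0 ≤ γ)
    (q : (Fin d → ℤ) × (Fin d → ℤ)) : 0 ≤ errorWeight κ ρ γ q := by
  have h := fun e => locError_nonneg (fun q : (Fin d → ℤ) × (Fin d → ℤ) => (direction q).re)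
    (fun q => (direction q).im) e q
  have h1 := Finset.sum_nonneg fun j (_ : j ∈ (Finset.univ : Finset (Fin d))) =>
    add_nonneg (h (Pi.single j 1, 0)) (h (0, Pi.single j 1))
  have h2 := Finset.sum_nonneg fun j (_ : j ∈ (Finset.univ : Finset (Fin d))) =>
    h (Pi.single j 1, Pi.single j 1)
  have h3 : (0 : ℝ) ≤ if q = 0 then 1 else 0 := by split_ifs <;> norm_num
  unfold errorWeight
  positivity

/-- Two-particle form bound up to a potential vanishing at infinity. -/
lemma form_le_of_localization (hκ : 0 ≤ κ) (hρ : 0 ≤ ρ) (hγ : 0 ≤ γ) {m : ℝ}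
    (hm : ∀ u : (Fin d → ℤ) → ℝ, (Summable fun x => u x ^ 2) →
      -((κ + ρ) * ∑ j : Fin d, energy (Pi.single j 1) u) + γ * u 0 ^ 2 ≤ m * ∑' x, u x ^ 2)
    (hf : Summable fun q => f q ^ 2) :
    (Summable fun q => errorWeight κ ρ γ q * f q ^ 2) ∧
    -kinetic κ ρ f f + γ * (potFst f f + potSnd f f) ≤
      m * ∑' q, f q ^ 2 + ∑' q, errorWeight κ ρ γ q * f q ^ 2 := by
  set c : (Fin d → ℤ) × (Fin d → ℤ) → ℝ := fun q => (direction q).re with hc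
  set s : (Fin d → ℤ) × (Fin d → ℤ) → ℝ := fun q => (direction q).im with hs
  have h1 : ∀ q, c q ^ 2 + s q ^ 2 = 1 := re_sq_add_im_sq_direction
  have h1' : ∀ q, s q ^ 2 + c q ^ 2 = 1 := fun q => by rw [add_comm]; exact h1 q
  have hcf := summable_mul_sq_left h1 hf
  have hsf := summable_mul_sq_left h1' hf
  have hb1 := potFst_bound hκ hρ hm hcf
  have hb2 := potSnd_bound hκ hρ hm hsf
  have hnorm : ∑' q, (c q * f q) ^ 2 + ∑' q, (s q * f q) ^ 2 = ∑' q, f q ^ 2 := by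
    rw [← hcf.tsum_add hsf]
    exact tsum_congr fun q => by linear_combination f q ^ 2 * h1 q
  have hl := fun e => energy_localization h1 hf e
  have hw : ∀ e, Summable fun q => locError c s e q * f q ^ 2 := fun e =>
    summable_bounded_mul_sq (locError_nonneg c s e) (locError_le h1 e) hf
  have h0 : Summable fun q => (if q = 0 then (1 : ℝ) else 0) * f q ^ 2 :=
    summable_ite_mul (fun q => q = 0) hf
  have hsum : HasSum (fun q => errorWeight κ ρ γ q * f q ^ 2)
      (κ * ∑ j : Fin d, (∑' q, locError c s (Pi.single j 1, 0) q * f q ^ 2 +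
          ∑' q, locError c s (0, Pi.single j 1) q * f q ^ 2)
        + ρ * ∑ j : Fin d, ∑' q, locError c s (Pi.single j 1, Pi.single j 1) q * f q ^ 2
        + γ * ∑' q, (if q = 0 then (1 : ℝ) else 0) * f q ^ 2) := by
    have e1 := hasSum_sum fun j (_ : j ∈ (Finset.univ : Finset (Fin d))) =>
      (hw (Pi.single j 1, 0)).hasSum.add (hw (0, Pi.single j 1)).hasSum
    have e2 := hasSum_sum fun j (_ : j ∈ (Finset.univ : Finset (Fin d))) =>
      (hw (Pi.single j 1, Pi.single j 1)).hasSum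
    refine (((e1.mul_left κ).add (e2.mul_left ρ)).add (h0.hasSum.mul_left γ)).congr_fun
      fun q => ?_
    simp only [errorWeight, ← add_mul, ← Finset.sum_mul]
    ring
  refine ⟨hsum.summable, ?_⟩
  have hk : kinetic κ ρ (fun q => c q * f q) (fun q => c q * f q) +
      kinetic κ ρ (fun q => s q * f q) (fun q => s q * f q) ≤ kinetic κ ρ f f +
      (κ * ∑ j : Fin d, (∑' q, locError c s (Pi.single j 1, 0) q * f q ^ 2 +
          ∑' q, locError c s (0, Pi.single j 1) q * f q ^ 2)
        + ρ * ∑ j : Fin d, ∑' q, locError c s (Pi.single j 1, Pi.single j 1) q * f q ^ 2) := by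
    have e1 := mul_le_mul_of_nonneg_left (Finset.sum_le_sum
      fun j (_ : j ∈ (Finset.univ : Finset (Fin d))) =>
        add_le_add (hl (Pi.single j 1, 0)) (hl (0, Pi.single j 1))) hκ
    have e2 := mul_le_mul_of_nonneg_left (Finset.sum_le_sum
      fun j (_ : j ∈ (Finset.univ : Finset (Fin d))) =>
        hl (Pi.single j 1, Pi.single j 1)) hρ
    simp only [kinetic, dirichlet_self]
    simp only [Finset.sum_add_distrib] at e1 e2 ⊢
    linarith
  have hp : potFst f f + potSnd f f ≤ potFst (fun q => c q * f q) (fun q => c q * f q) +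
      potSnd (fun q => s q * f q) (fun q => s q * f q) +
      ∑' q, (if q = 0 then (1 : ℝ) else 0) * f q ^ 2 := by
    have a1 := summable_ite_mul (fun q : (Fin d → ℤ) × (Fin d → ℤ) => q.1 = 0)
      (summable_mul_of_sq hf hf)
    have a2 := summable_ite_mul (fun q : (Fin d → ℤ) × (Fin d → ℤ) => q.2 = 0)
      (summable_mul_of_sq hf hf)
    have b1 := summable_ite_mul (fun q : (Fin d → ℤ) × (Fin d → ℤ) => q.1 = 0)
      (summable_mul_of_sq hcf hcf)
    have b2 := summable_ite_mul (fun q : (Fin d → ℤ) × (Fin d → ℤ) => q.2 = 0)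
      (summable_mul_of_sq hsf hsf)
    unfold potFst potSnd
    rw [← a1.tsum_add a2, ← b1.tsum_add b2, ← (b1.add b2).tsum_add h0]
    refine (a1.add a2).tsum_le_tsum (fun q => ?_) ((b1.add b2).add h0)
    by_cases hq1 : q.1 = 0 <;> by_cases hq2 : q.2 = 0
    · have hq : q = 0 := Prod.ext hq1 hq2
      simp only [if_pos hq1, if_pos hq2, if_pos hq]
      linarith [congrArg (fun t => t * f q ^ 2) (h1 q)]
    · have hq : q ≠ 0 := fun h => hq2 (by rw [h]; rfl)
      have e : c q ^ 2 = 1 := re_direction_sq hq1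
      simp only [hq1, hq2, hq, if_true, if_false]
      linarith [congrArg (fun t => t * f q ^ 2) e]
    · have hq : q ≠ 0 := fun h => hq1 (by rw [h]; rfl)
      have e : s q ^ 2 = 1 := im_direction_sq hq1 hq2
      simp only [hq1, hq2, hq, if_true, if_false]
      linarith [congrArg (fun t => t * f q ^ 2) e]
    · have hq : q ≠ 0 := fun h => hq1 (by rw [h]; rfl)
      simp [hq1, hq2, hq]
  rw [hsum.tsum_eq]
  have hp' := mul_le_mul_of_nonneg_left hp hγ
  rw [← hnorm, mul_add]
  linarith

/-- Two-particle form bound up to finitely many sites. -/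
lemma form_le_of_finite_sites (hκ : 0 ≤ κ) (hρ : 0 ≤ ρ) (hγ : 0 ≤ γ) {m δ : ℝ} (hδ : 0 < δ)
    (hm : ∀ u : (Fin d → ℤ) → ℝ, (Summable fun x => u x ^ 2) →
      -((κ + ρ) * ∑ j : Fin d, energy (Pi.single j 1) u) + γ * u 0 ^ 2 ≤ m * ∑' x, u x ^ 2) :
    ∃ (F : Finset ((Fin d → ℤ) × (Fin d → ℤ))) (C : ℝ), 0 ≤ C ∧
      ∀ f : (Fin d → ℤ) × (Fin d → ℤ) → ℝ, (Summable fun q => f q ^ 2) →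
        -kinetic κ ρ f f + γ * (potFst f f + potSnd f f) ≤
          (m + δ) * ∑' q, f q ^ 2 + C * ∑ q ∈ F, f q ^ 2 := by
  have hfin : {q | ¬ errorWeight (d := d) κ ρ γ q < δ}.Finite :=
    (tendsto_errorWeight (d := d) κ ρ γ).eventually_lt_const hδ
  have h0 := errorWeight_nonneg (d := d) hκ hρ hγ
  refine ⟨hfin.toFinset, ∑ q ∈ hfin.toFinset, errorWeight κ ρ γ q,
    Finset.sum_nonneg fun q _ => h0 q, fun f hf => ?_⟩
  obtain ⟨hs, hle⟩ := form_le_of_localization hκ hρ hγ hm hf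
  set F := hfin.toFinset with hF
  set C := ∑ q ∈ F, errorWeight κ ρ γ q with hC
  have hFs : HasSum (fun q => if q ∈ F then C * f q ^ 2 else 0) (∑ q ∈ F, C * f q ^ 2) := by
    have : HasSum (fun q => if q ∈ F then C * f q ^ 2 else 0)
        (∑ q ∈ F, if q ∈ F then C * f q ^ 2 else 0) :=
      hasSum_sum_of_ne_finset_zero fun q hq => if_neg hq
    rwa [Finset.sum_congr rfl fun q hq => if_pos hq] at this
  have h1 : ∑' q, errorWeight κ ρ γ q * f q ^ 2 ≤ δ * ∑' q, f q ^ 2 + C * ∑ q ∈ F, f q ^ 2 := by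
    rw [Finset.mul_sum, ← hFs.tsum_eq, ← tsum_mul_left, ← (hf.mul_left δ).tsum_add hFs.summable]
    refine hs.tsum_le_tsum (fun q => ?_) ((hf.mul_left δ).add hFs.summable)
    by_cases hq : q ∈ F
    · rw [if_pos hq]
      have h2 : errorWeight κ ρ γ q ≤ C := Finset.single_le_sum (fun q _ => h0 q) hq
      nlinarith [sq_nonneg (f q)]
    · rw [if_neg hq, add_zero]
      have h2 : errorWeight κ ρ γ q < δ := by simpa [hF] using hq
      gcongr
  linarith

end Lattice

section Operator

variable {d : ℕ} {κ ρ γ : ℝ}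

lemma dirichlet_form_comm (f g : (Fin d → ℤ) × (Fin d → ℤ) → ℝ) :
    -kinetic κ ρ f g + γ * (potFst f g + potSnd f g) =
      -kinetic κ ρ g f + γ * (potFst g f + potSnd g f) := by
  simp only [kinetic, potFst, potSnd, dirichlet_comm _ f g, mul_comm (f _) (g _)]

lemma inner_apply_eq_form
    {H2 : lp (fun _ : (Fin d → ℤ) × (Fin d → ℤ) => ℝ) 2 →L[ℝ]
      lp (fun _ : (Fin d → ℤ) × (Fin d → ℤ) => ℝ) 2}
    (hH2 : ∀ (f : lp (fun _ : (Fin d → ℤ) × (Fin d → ℤ) => ℝ) 2)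
        (q : (Fin d → ℤ) × (Fin d → ℤ)),
      H2 f q = κ * (∑ j : Fin d,
          ((f (q.1 + Pi.single j 1, q.2) - f q) + (f (q.1 - Pi.single j 1, q.2) - f q)
            + (f (q.1, q.2 + Pi.single j 1) - f q) + (f (q.1, q.2 - Pi.single j 1) - f q)))
        + ρ * (∑ j : Fin d,
          ((f (q.1 + Pi.single j 1, q.2 + Pi.single j 1) - f q)
            + (f (q.1 - Pi.single j 1, q.2 - Pi.single j 1) - f q)))
        + γ * (((if q.1 = 0 then (1:ℝ) else 0) + (if q.2 = 0 then (1:ℝ) else 0)) * f q))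
    (f g : lp (fun _ : (Fin d → ℤ) × (Fin d → ℤ) => ℝ) 2) :
    inner ℝ (H2 f) g = -kinetic κ ρ f g + γ * (potFst f g + potSnd f g) := by
  have hf := summable_sq_coe f
  have hg := summable_sq_coe g
  have hl := hasSum_laplace hf hg
  have e1 := hasSum_sum fun j (_ : j ∈ (Finset.univ : Finset (Fin d))) =>
    (hl (Pi.single j 1, 0)).add (hl (0, Pi.single j 1))
  have e2 := hasSum_sum fun j (_ : j ∈ (Finset.univ : Finset (Fin d))) =>
    hl (Pi.single j 1, Pi.single j 1)
  have p1 := (summable_ite_mul (fun q : (Fin d → ℤ) × (Fin d → ℤ) => q.1 = 0)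
    (summable_mul_of_sq hf hg)).hasSum
  have p2 := (summable_ite_mul (fun q : (Fin d → ℤ) × (Fin d → ℤ) => q.2 = 0)
    (summable_mul_of_sq hf hg)).hasSum
  have hs := ((e1.mul_left κ).add (e2.mul_left ρ)).add ((p1.add p2).mul_left γ)
  have hs' : HasSum (fun q => inner ℝ (H2 f q) (g q)) _ := hs.congr_fun fun q => by
    have a1 : ∀ b : Fin d → ℤ, q + (b, 0) = (q.1 + b, q.2) := fun b => by ext <;> simp
    have a2 : ∀ b : Fin d → ℤ, q + (0, b) = (q.1, q.2 + b) := fun b => by ext <;> simp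
    have a3 : ∀ b : Fin d → ℤ, q + (b, b) = (q.1 + b, q.2 + b) := fun b => rfl
    have a4 : ∀ b : Fin d → ℤ, q - (b, 0) = (q.1 - b, q.2) := fun b => by ext <;> simp
    have a5 : ∀ b : Fin d → ℤ, q - (0, b) = (q.1, q.2 - b) := fun b => by ext <;> simp
    have a6 : ∀ b : Fin d → ℤ, q - (b, b) = (q.1 - b, q.2 - b) := fun b => rfl
    have hin : inner ℝ (H2 f q) (g q) = H2 f q * g q := by simp [mul_comm]
    rw [hin, hH2]
    simp only [a1, a2, a3, a4, a5, a6, ← add_mul, ← Finset.sum_mul]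
    simp only [add_assoc]
    ring
  rw [(lp.hasSum_inner (H2 f) g).unique hs']
  simp only [kinetic, potFst, potSnd, Finset.sum_neg_distrib, Finset.sum_add_distrib]
  ring

/-- Evaluation of `ℓ²` functions on a finite set of sites. -/
noncomputable def evalFinset {α : Type*} (F : Finset α) :
    lp (fun _ : α => ℝ) 2 →L[ℝ] (F → ℝ) :=
  ContinuousLinearMap.pi fun q =>
    { toFun := fun f => f q
      map_add' := fun _ _ => rfl
      map_smul' := fun _ _ => rfl
      cont := (lp.lipschitzWith_one_eval 2 (q : α)).continuous }

lemma sum_sq_le_norm_evalFinset {α : Type*} (F : Finset α) (f : lp (fun _ : α => ℝ) 2) :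
    ∑ q ∈ F, f q ^ 2 ≤ F.card * ‖evalFinset F f‖ ^ 2 := by
  rw [← nsmul_eq_mul]
  refine Finset.sum_le_card_nsmul _ _ _ fun q hq => ?_
  have h1 : ‖f q‖ ≤ ‖evalFinset F f‖ := norm_le_pi_norm (evalFinset F f) ⟨q, hq⟩
  rw [← sq_abs, ← Real.norm_eq_abs]
  gcongr

/-- A vector at which a symmetric operator's form attains its upper bound is an eigenvector. -/
lemma apply_eq_smul_of_form_eq {E : Type*} [NormedAddCommGroup E] [InnerProductSpace ℝ E]
    {T : E →L[ℝ] E} (hT : (T : E →ₗ[ℝ] E).IsSymmetric) {M : ℝ}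
    (hM : ∀ x, inner ℝ (T x) x ≤ M * ‖x‖ ^ 2) {x : E} (hx : M * ‖x‖ ^ 2 ≤ inner ℝ (T x) x) :
    T x = M • x := by
  have hin : ∀ y, inner ℝ ((algebraMap ℝ (E →L[ℝ] E) M - T) y) y =
      M * ‖y‖ ^ 2 - inner ℝ (T y) y := fun y => by
    simp [Algebra.algebraMap_eq_smul_one, inner_sub_left, inner_smul_left]
  have h1 := norm_sq_apply_le_of_nonneg (isSymmetric_smul_id_sub hT M)
    (fun y => by rw [hin]; linarith [hM y]) x
  rw [hin, le_antisymm (hM x) hx, sub_self, mul_zero] at h1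
  have h2 : (algebraMap ℝ (E →L[ℝ] E) M - T) x = 0 := by
    rw [← norm_eq_zero]
    exact pow_eq_zero_iff two_ne_zero |>.1 (le_antisymm h1 (sq_nonneg _))
  have h3 : M • x - T x = 0 := by
    simpa [Algebra.algebraMap_eq_smul_one] using h2
  exact (sub_eq_zero.1 h3).symm

lemma isClosed_symmetric {S : Submodule ℝ (lp (fun _ : (Fin d → ℤ) × (Fin d → ℤ) => ℝ) 2)}
    (hS : ∀ f : lp (fun _ : (Fin d → ℤ) × (Fin d → ℤ) => ℝ) 2,
      f ∈ S ↔ ∀ a b : Fin d → ℤ, f (a, b) = f (b, a)) :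
    IsClosed (S : Set (lp (fun _ : (Fin d → ℤ) × (Fin d → ℤ) => ℝ) 2)) := by
  have hset : (S : Set (lp (fun _ : (Fin d → ℤ) × (Fin d → ℤ) => ℝ) 2)) =
      ⋂ (x : Fin d → ℤ) (y : Fin d → ℤ), {g | g (x, y) = g (y, x)} := by
    ext g
    simp only [SetLike.mem_coe, hS, Set.mem_iInter, Set.mem_ofPred_eq]
  rw [hset]
  exact isClosed_iInter fun x => isClosed_iInter fun y => isClosed_eq
    (lp.lipschitzWith_one_eval 2 (x, y)).continuous (lp.lipschitzWith_one_eval 2 (y, x)).continuous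

/-- The form is bounded by half its optimal constant plus an arbitrarily small error, up to
finitely many sites. -/
lemma exists_finite_rank_bound (hκ : 0 ≤ κ) (hρ : 0 ≤ ρ) (hγ : 0 ≤ γ) {M : ℝ} (hMpos : 0 < M)
    {H2 : lp (fun _ : (Fin d → ℤ) × (Fin d → ℤ) => ℝ) 2 →L[ℝ]
      lp (fun _ : (Fin d → ℤ) × (Fin d → ℤ) => ℝ) 2}
    (hform : ∀ f g, inner ℝ (H2 f) g = -kinetic κ ρ f g + γ * (potFst f g + potSnd f g))
    (hle : ∀ f, inner ℝ (H2 f) f ≤ M * ‖f‖ ^ 2) :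
    ∃ (F : Finset ((Fin d → ℤ) × (Fin d → ℤ))) (C : ℝ), 0 ≤ C ∧
      ∀ f, inner ℝ (H2 f) f ≤ 3 / 4 * M * ‖f‖ ^ 2 + C * ‖evalFinset F f‖ ^ 2 := by
  have hM : ∀ f : (Fin d → ℤ) × (Fin d → ℤ) → ℝ, (Summable fun q => f q ^ 2) →
      -kinetic κ ρ f f + γ * (potFst f f + potSnd f f) ≤ M * ∑' q, f q ^ 2 := fun f hf => by
    have h := hle (toL2 f hf)
    rwa [hform, norm_sq_eq_tsum_sq] at h
  obtain ⟨F, C, hC, hFC⟩ := form_le_of_finite_sites hκ hρ hγ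
    (by positivity : 0 < M / 4) fun u hu => one_particle_bound hρ hM hu
  refine ⟨F, C * F.card, by positivity, fun f => ?_⟩
  have h := hFC f (summable_sq_coe f)
  rw [← hform, ← norm_sq_eq_tsum_sq] at h
  have h' := mul_le_mul_of_nonneg_left (sum_sq_le_norm_evalFinset F f) hC
  linarith

/-- If the optimal form bound is attained, it is attained at a symmetric function. -/
lemma exists_symmetric_eigenvector (hκ : 0 ≤ κ) (hρ : 0 ≤ ρ) {M : ℝ}
    {H2 : lp (fun _ : (Fin d → ℤ) × (Fin d → ℤ) => ℝ) 2 →L[ℝ]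
      lp (fun _ : (Fin d → ℤ) × (Fin d → ℤ) => ℝ) 2}
    (hform : ∀ f g, inner ℝ (H2 f) g = -kinetic κ ρ f g + γ * (potFst f g + potSnd f g))
    (hsym : (H2 : lp (fun _ : (Fin d → ℤ) × (Fin d → ℤ) => ℝ) 2 →ₗ[ℝ]
      lp (fun _ : (Fin d → ℤ) × (Fin d → ℤ) => ℝ) 2).IsSymmetric)
    (hle : ∀ f, inner ℝ (H2 f) f ≤ M * ‖f‖ ^ 2)
    {f : lp (fun _ : (Fin d → ℤ) × (Fin d → ℤ) => ℝ) 2} (hf1 : ‖f‖ = 1)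
    (hf : H2 f = M • f) :
    ∃ g : lp (fun _ : (Fin d → ℤ) × (Fin d → ℤ) => ℝ) 2, g ≠ 0 ∧ H2 g = M • g ∧
      ∀ x y : Fin d → ℤ, g (x, y) = g (y, x) := by
  have hfs := summable_sq_coe f
  have has : Summable fun q => |f q| ^ 2 := by simpa only [sq_abs] using hfs
  obtain ⟨a, ha⟩ : ∃ a : lp (fun _ : (Fin d → ℤ) × (Fin d → ℤ) => ℝ) 2, ∀ q, a q = |f q| :=
    ⟨toL2 (fun q => |f q|) has, fun _ => rfl⟩
  obtain ⟨b, hb⟩ : ∃ b : lp (fun _ : (Fin d → ℤ) × (Fin d → ℤ) => ℝ) 2, ∀ q, b q = a q.swap :=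
    ⟨toL2 (fun q => a q.swap) (summable_sq_swap (summable_sq_coe a)), fun _ => rfl⟩
  have hac : (a : (Fin d → ℤ) × (Fin d → ℤ) → ℝ) = fun q => |f q| := funext ha
  have hbc : (b : (Fin d → ℤ) × (Fin d → ℤ) → ℝ) = fun q => a q.swap := funext hb
  have han : ‖a‖ ^ 2 = ‖f‖ ^ 2 := by
    simp only [norm_sq_eq_tsum_sq, ha, sq_abs]
  have hbn : ‖b‖ ^ 2 = ‖a‖ ^ 2 := by
    simp only [norm_sq_eq_tsum_sq, hb]
    exact (Equiv.prodComm (Fin d → ℤ) (Fin d → ℤ)).tsum_eq fun q => a q ^ 2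
  have hfa : inner ℝ (H2 f) f ≤ inner ℝ (H2 a) a := by
    have hk : kinetic κ ρ a a ≤ kinetic κ ρ f f := by
      rw [hac]
      simp only [kinetic, dirichlet_self]
      gcongr <;> exact energy_abs_le hfs _
    have h1 : potFst a a = potFst f f := tsum_congr fun q => by rw [ha, abs_mul_abs_self]
    have h2 : potSnd a a = potSnd f f := tsum_congr fun q => by rw [ha, abs_mul_abs_self]
    rw [hform, hform, h1, h2]
    linarith
  have hab : inner ℝ (H2 b) b = inner ℝ (H2 a) a := by
    rw [hform, hform, hbc, kinetic_comp_swap, potFst_comp_swap, potSnd_comp_swap,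
      add_comm (potSnd (d := d) a a)]
  have hff : inner ℝ (H2 f) f = M * ‖f‖ ^ 2 := by
    rw [hf, inner_smul_left, real_inner_self_eq_norm_sq]; simp
  have hae : H2 a = M • a := apply_eq_smul_of_form_eq hsym hle (by rw [han, ← hff]; exact hfa)
  have hbe : H2 b = M • b := apply_eq_smul_of_form_eq hsym hle (by
    rw [hbn, han, ← hff, hab]; exact hfa)
  have hab0 : a + b ≠ 0 := fun h => by
    have hf0 : f = 0 := by
      ext q
      have h1 : (a + b : lp (fun _ : (Fin d → ℤ) × (Fin d → ℤ) => ℝ) 2) q = 0 := by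
        rw [h, lp.coeFn_zero, Pi.zero_apply]
      rw [lp.coeFn_add, Pi.add_apply, hb, ha, ha] at h1
      exact abs_eq_zero.1 (by linarith [abs_nonneg (f q), abs_nonneg (f q.swap)])
    rw [hf0, norm_zero] at hf1
    exact zero_ne_one hf1
  refine ⟨a + b, hab0, by rw [map_add, hae, hbe, smul_add], fun x y => ?_⟩
  rw [lp.coeFn_add, Pi.add_apply, Pi.add_apply, hb, hb, Prod.swap_prod_mk, Prod.swap_prod_mk,
    add_comm]

end Operator

/-- Suppose `γ > 0` and `λ₂ := sup σ(H²) > 0`, where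
`H² = A² + γV²` on `ℓ²(ℤ^d × ℤ^d)`. Then `λ₂` is isolated in the spectrum of the
restriction `H²_S` of `H²` to the subspace `S` of symmetric functions: there is
`ε > 0` with `σ(H²_S) ∩ (λ₂ − ε, λ₂ + ε) = {λ₂}`. -/
theorem lambda2_isolated_in_spectrum_symmetric
    (d : ℕ) (hd : 1 ≤ d)
    (κ ρ γ : ℝ) (hκ : 0 < κ) (hρ : 0 < ρ) (hγ : 0 < γ)
    (H2 : lp (fun _ : (Fin d → ℤ) × (Fin d → ℤ) => ℝ) 2 →L[ℝ]
      lp (fun _ : (Fin d → ℤ) × (Fin d → ℤ) => ℝ) 2)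
    (hH2 : ∀ (f : lp (fun _ : (Fin d → ℤ) × (Fin d → ℤ) => ℝ) 2)
        (q : (Fin d → ℤ) × (Fin d → ℤ)),
      H2 f q = κ * (∑ j : Fin d,
          ((f (q.1 + Pi.single j 1, q.2) - f q) + (f (q.1 - Pi.single j 1, q.2) - f q)
            + (f (q.1, q.2 + Pi.single j 1) - f q) + (f (q.1, q.2 - Pi.single j 1) - f q)))
        + ρ * (∑ j : Fin d,
          ((f (q.1 + Pi.single j 1, q.2 + Pi.single j 1) - f q)
            + (f (q.1 - Pi.single j 1, q.2 - Pi.single j 1) - f q)))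
        + γ * (((if q.1 = 0 then (1:ℝ) else 0) + (if q.2 = 0 then (1:ℝ) else 0)) * f q))
    (hlam : 0 < sSup (spectrum ℝ H2))
    (S : Submodule ℝ (lp (fun _ : (Fin d → ℤ) × (Fin d → ℤ) => ℝ) 2))
    (hS : ∀ f : lp (fun _ : (Fin d → ℤ) × (Fin d → ℤ) => ℝ) 2,
      f ∈ S ↔ ∀ a b : Fin d → ℤ, f (a, b) = f (b, a))
    (HS : S →L[ℝ] S)
    (hHS : ∀ v : S, (HS v : lp (fun _ : (Fin d → ℤ) × (Fin d → ℤ) => ℝ) 2)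
      = H2 (v : lp (fun _ : (Fin d → ℤ) × (Fin d → ℤ) => ℝ) 2)) :
    ∃ ε : ℝ, 0 < ε ∧
      spectrum ℝ HS ∩ Set.Ioo (sSup (spectrum ℝ H2) - ε) (sSup (spectrum ℝ H2) + ε)
        = {sSup (spectrum ℝ H2)} := by
  have hform := inner_apply_eq_form hH2
  have hsym : (H2 : lp (fun _ : (Fin d → ℤ) × (Fin d → ℤ) => ℝ) 2 →ₗ[ℝ]
      lp (fun _ : (Fin d → ℤ) × (Fin d → ℤ) => ℝ) 2).IsSymmetric := fun f g => by
    rw [ContinuousLinearMap.coe_coe, hform, real_inner_comm, hform, dirichlet_form_comm]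
  have hle := inner_apply_self_le_sSup_spectrum hsym
  obtain ⟨F, C, hC, hb⟩ := exists_finite_rank_bound hκ.le hρ.le hγ.le hlam hform hle
  have hMmem : sSup (spectrum ℝ H2) ∈ spectrum ℝ H2 := by
    refine (spectrum.isCompact H2).sSup_mem (Set.nonempty_iff_ne_empty.2 fun h => ?_)
    rw [h, Real.sSup_empty] at hlam
    exact lt_irrefl _ hlam
  obtain ⟨f, hf1, hf⟩ := exists_eigenvector_of_finite_rank_bound hsym (evalFinset F)
    hC hb hMmem (by linarith)
  obtain ⟨g, hg0, hg, hgS⟩ := exists_symmetric_eigenvector hκ.le hρ.le hform hsym hle hf1 hf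
  have : CompleteSpace S := (isClosed_symmetric hS).completeSpace_coe
  exact exists_spectrum_inter_Ioo_eq_singleton (fun v w => by
      simp only [ContinuousLinearMap.coe_coe, Submodule.coe_inner, hHS]
      exact hsym v w)
    ((evalFinset F).comp S.subtypeL) hC (fun v => by
      rw [Submodule.coe_inner, hHS]
      exact hb v)
    (by linarith) (mem_spectrum_restrict hHS ((hS g).2 hgS) hg0 hg)
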